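/- Let X be a set equipped with a family of binary operations f_i : X × X → X indexed by a set I. Let ≤₁ be a reflexive and transitive relation (preorder) on X; write a <₁ b for (a ≤₁ b and not b ≤₁ a) and a ≈₁ b for (a ≤₁ b and b ≤₁ a). Let ≤₂ be a binary relation on X. Assume: (i) ≤₁ is admissible with respect to the family f_i; (ii) strict compatibility: for every i, if a <₁ a' and b ≤₁ b', or if a ≤₁ a' and b <₁ b', then f_i(a,b) <₁ f_i(a',b'); (iii) ≤₂ is admissible with respect to the family f_i. Then the relation ≤ defined by a ≤ b if and only if a <₁ b, or (a ≈₁ b and a ≤₂ b), is admissible with respect to the family f_i. -/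

import Mathlib

/-- A binary relation `r` on `X` is admissible with respect to a family of binary
operations `f i : X → X → X` if it is compatible with each operation in both
arguments simultaneously. -/
def Admissible {X I : Type*} (f : I → X → X → X) (r : X → X → Prop) : Prop :=
  ∀ i a a' b b', r a a' → r b b' → r (f i a b) (f i a' b')

/-- The strict part `a <₁ b` of a relation: `a ≤₁ b` and not `b ≤₁ a`. -/
def StrictPart {X : Type*} (r : X → X → Prop) (a b : X) : Prop := r a b ∧ ¬ r b a

/-- The equivalence part `a ≈₁ b` of a relation: `a ≤₁ b` and `b ≤₁ a`. -/
def EquivPart {X : Type*} (r : X → X → Prop) (a b : X) : Prop := r a b ∧ r b a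

/-- The nested relation: `a ≤ b` iff `a <₁ b`, or `a ≈₁ b` and `a ≤₂ b`. -/
def NestedRel {X : Type*} (r₁ r₂ : X → X → Prop) (a b : X) : Prop :=
  StrictPart r₁ a b ∨ (EquivPart r₁ a b ∧ r₂ a b)

/-- If `≤₁` is a preorder that is admissible and strictly compatible with a family of
binary operations, and `≤₂` is admissible with respect to the same family, then the
nested relation (`<₁`, then `≤₂` on `≈₁`-equivalent elements) is admissible. -/
theorem nested_admissible_is_admissible {X I : Type*} (f : I → X → X → X)
    (le₁ le₂ : X → X → Prop)
    (hrefl : ∀ a, le₁ a a)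
    (htrans : ∀ a b c, le₁ a b → le₁ b c → le₁ a c)
    (hadm₁ : Admissible f le₁)
    (hstrict : ∀ i a a' b b',
      (StrictPart le₁ a a' ∧ le₁ b b') ∨ (le₁ a a' ∧ StrictPart le₁ b b') →
        StrictPart le₁ (f i a b) (f i a' b'))
    (hadm₂ : Admissible f le₂) :
    Admissible f (NestedRel le₁ le₂) := by
  rintro i a a' b b' (ha | ⟨ha, ha₂⟩) (hb | ⟨hb, hb₂⟩)
  · exact .inl (hstrict i a a' b b' (.inl ⟨ha, hb.1⟩))
  · exact .inl (hstrict i a a' b b' (.inl ⟨ha, hb.1⟩))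
  · exact .inl (hstrict i a a' b b' (.inr ⟨ha.1, hb⟩))
  · exact .inr ⟨⟨hadm₁ i a a' b b' ha.1 hb.1, hadm₁ i a' a b' b ha.2 hb.2⟩,
      hadm₂ i a a' b b' ha₂ hb₂⟩
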